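/- Let n ≥ 1 and let λ₁, …, λₙ ∈ ℝ satisfy λᵢ λⱼ ≥ −1 for all i, j. If a symmetric 3-tensor h on ℝⁿ satisfies ∑_{i,j,k} h_{ijk}² + ∑_{k,i} λᵢ² h_{iik}² + 2 ∑_{k} ∑_{i<j} λᵢ λⱼ h_{ijk}² = 0, then h_{ijk} = 0 for all i, j, k. -/

import Mathlib

/-- A double sum of a symmetric function is its diagonal part plus twice its strictly upper
triangular part. -/
theorem Finset.sum_sum_eq_diag_add_two_mul_sum_Ioi {ι R : Type*} [CommRing R] [Fintype ι]
    [LinearOrder ι] [LocallyFiniteOrderTop ι] (f : ι → ι → R)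
    (hf : ∀ i j, f i j = f j i) :
    ∑ i, ∑ j, f i j = ∑ i, f i i + 2 * ∑ i, ∑ j ∈ Finset.Ioi i, f i j := by
  have hrow (i : ι) : ∑ j, f i j =
      f i i + ∑ j ∈ Finset.Ioi i, f i j + ∑ j ∈ Finset.univ.filter (· < i), f i j := by
    rw [← Finset.sum_filter_add_sum_filter_not Finset.univ (· < i), add_comm]
    congr 1
    have hset : Finset.univ.filter (fun j => ¬ j < i) = insert i (Finset.Ioi i) := by
      ext j
      simp [le_iff_eq_or_lt]
    rw [hset, Finset.sum_insert (by simp)]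
  have hswap : ∑ i, ∑ j ∈ Finset.univ.filter (· < i), f i j =
      ∑ i, ∑ j ∈ Finset.Ioi i, f i j := by
    rw [Finset.sum_comm' (t' := Finset.univ) (s' := Finset.Ioi) (by simp)]
    simp only [hf]
  simp only [hrow, Finset.sum_add_distrib, hswap]
  ring

/-- **Rigidity of the curvature quadratic form on `Ξ`.** If `λ₁, …, λₙ` satisfy
`λᵢ λⱼ ≥ -1` for all `i, j`, and a symmetric 3-tensor `h` on `ℝⁿ` satisfies
`∑_{i,j,k} h_{ijk}² + ∑_{k,i} λᵢ² h_{iik}² + 2 ∑_k ∑_{i<j} λᵢ λⱼ h_{ijk}² = 0`,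
then `h = 0`. -/
theorem curvature_form_eq_zero_implies_tensor_zero
    (n : ℕ) (hn : 1 ≤ n) (lam : Fin n → ℝ)
    (hlam : ∀ i j, -1 ≤ lam i * lam j)
    (h : Fin n → Fin n → Fin n → ℝ)
    (hsymm1 : ∀ i j k, h i j k = h j i k)
    (hsymm2 : ∀ i j k, h i j k = h i k j)
    (hzero : (∑ i, ∑ j, ∑ k, (h i j k) ^ 2) + (∑ k, ∑ i, (lam i) ^ 2 * (h i i k) ^ 2)
        + 2 * ∑ k, ∑ i, ∑ j ∈ Finset.Ioi i, lam i * lam j * (h i j k) ^ 2 = 0) :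
    ∀ i j k, h i j k = 0 := by
  have hsum : ∑ k, ∑ i, ∑ j, (1 + lam i * lam j) * (h i j k) ^ 2 = 0 := by
    have hcomm : ∑ i, ∑ j, ∑ k, (h i j k) ^ 2 = ∑ k, ∑ i, ∑ j, (h i j k) ^ 2 := by
      rw [Finset.sum_comm (s := Finset.univ (α := Fin n))]
      simp only [hsymm1, hsymm2]
    have htri (k : Fin n) := Finset.sum_sum_eq_diag_add_two_mul_sum_Ioi
      (fun i j => lam i * lam j * (h i j k) ^ 2)
      (fun i j => by rw [hsymm1 i j k, mul_comm (lam i)])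
    rw [hcomm] at hzero
    simp only [add_mul, one_mul, Finset.sum_add_distrib, htri, ← Finset.mul_sum]
    simp only [← pow_two]
    linarith
  have hnonneg (i j k : Fin n) : 0 ≤ (1 + lam i * lam j) * (h i j k) ^ 2 :=
    mul_nonneg (by linarith [hlam i j]) (sq_nonneg _)
  have hterm (i j k : Fin n) : (1 + lam i * lam j) * (h i j k) ^ 2 = 0 := by
    have hk := (Fintype.sum_eq_zero_iff_of_nonneg fun k =>
      Finset.sum_nonneg fun i _ => Finset.sum_nonneg fun j _ => hnonneg i j k).1 hsum
    have hi := (Fintype.sum_eq_zero_iff_of_nonneg fun i =>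
      Finset.sum_nonneg fun j _ => hnonneg i j k).1 (congrFun hk k)
    exact congrFun ((Fintype.sum_eq_zero_iff_of_nonneg fun j =>
      hnonneg i j k).1 (congrFun hi i)) j
  have hprod {i j k : Fin n} (hne : h i j k ≠ 0) : lam i * lam j = -1 := by
    linarith [(mul_eq_zero.1 (hterm i j k)).resolve_right (pow_ne_zero 2 hne)]
  intro i j k
  by_contra hne
  have hij : lam i * lam j = -1 := hprod hne
  have hik : lam i * lam k = -1 := hprod (hsymm2 i j k ▸ hne)
  have hjk : lam j * lam k = -1 := hprod (k := i) (by rwa [hsymm2, ← hsymm1])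
  have hsq : (lam i * lam j * lam k) ^ 2 = -1 := by
    linear_combination (lam i * lam k) * (lam j * lam k) * hij - (lam j * lam k) * hik + hjk
  linarith [sq_nonneg (lam i * lam j * lam k)]
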